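/- arXiv:0808.1434 — 6 statements merged into one kernel-verified Lean document; each statement's English description precedes it below -/
import Mathlib

section
/- For s ≥ 1 and 0 ≤ i with 2(s+i) ≤ 2m, the cardinality of F_i(2m, m, 2s) equals (1/2)·( C(2m, m) − Σ_{j=−(s−1)}^{s−1} C(2(s+i), s+i+j)·C(2m−2(s+i), m−(s+i+j)) ). -/
/-- The family `F_i(n,k,t)` of all k-subsets F of [n] with `|F ∩ [t+2i]| ≥ t+i`. -/
def Fam (n k t i : ℕ) : Finset (Finset ℕ) :=
  (Finset.Icc 1 n).powerset.filter fun F =>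
    F.card = k ∧ t + i ≤ (F ∩ Finset.Icc 1 (t + 2 * i)).card

/-- Binomial coefficient with integer lower index (zero when the index is negative). -/
def chooseZ (n : ℕ) (k : ℤ) : ℕ := if 0 ≤ k then n.choose k.toNat else 0

open Finset in
/-- The number of `m`-subsets of `U` meeting `A ⊆ U` in exactly `k` elements. -/
theorem card_filter_powersetCard_inter {α : Type*} [DecidableEq α] {U A : Finset α}
    (hA : A ⊆ U) {m k : ℕ} (hk : k ≤ m) :
    ((powersetCard m U).filter fun F => (F ∩ A).card = k).card =
      A.card.choose k * (U.card - A.card).choose (m - k) := by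
  rw [← card_sdiff_of_subset hA, ← card_powersetCard, ← card_powersetCard, ← card_product]
  have key : ∀ B C : Finset α, B ⊆ A → C ⊆ U \ A → (B ∪ C) ∩ A = B ∧ (B ∪ C) \ A = C := by
    intro B C hB hC
    constructor <;> ext x <;> have h₁ := @hB x <;> have h₂ := @hC x <;>
      simp only [mem_sdiff, mem_inter, mem_union] at * <;> tauto
  refine card_bij' (fun F _ => (F ∩ A, F \ A)) (fun P _ => P.1 ∪ P.2) ?_ ?_ ?_ ?_
  · intro F hF
    simp only [mem_filter, mem_powersetCard, mem_product] at hF ⊢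
    have h := card_inter_add_card_sdiff F A
    exact ⟨⟨inter_subset_right, hF.2⟩, sdiff_subset_sdiff hF.1.1 le_rfl, by omega⟩
  · rintro ⟨B, C⟩ hP
    simp only [mem_filter, mem_powersetCard, mem_product] at hP ⊢
    obtain ⟨⟨hB, hBk⟩, hC, hCk⟩ := hP
    obtain ⟨h₁, h₂⟩ := key B C hB hC
    have h := card_inter_add_card_sdiff (B ∪ C) A
    rw [h₁, h₂] at h
    exact ⟨⟨union_subset (hB.trans hA) (hC.trans sdiff_subset), by omega⟩, by rw [h₁, hBk]⟩
  · intro F _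
    simp only
    rw [union_comm, sdiff_union_inter]
  · rintro ⟨B, C⟩ hP
    simp only [mem_powersetCard, mem_product] at hP
    obtain ⟨h₁, h₂⟩ := key B C hP.1.1 hP.2.1
    simp only [h₁, h₂]

open Finset in
/-- Complementation in `U` exchanges the half-size sets with small and large trace on `A`. -/
theorem card_filter_le_card_inter_eq {α : Type*} [DecidableEq α] {U A : Finset α}
    (hA : A ⊆ U) {m k l : ℕ} (hU : U.card = 2 * m) (hkl : k + l = A.card) :
    ((powersetCard m U).filter fun F => (F ∩ A).card ≤ k).card =
      ((powersetCard m U).filter fun F => l ≤ (F ∩ A).card).card := by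
  have key : ∀ F ∈ powersetCard m U, U \ F ∈ powersetCard m U ∧ U \ (U \ F) = F ∧
      ((U \ F) ∩ A).card + (F ∩ A).card = A.card := by
    intro F hF
    rw [mem_powersetCard] at hF
    have h₁ := card_sdiff_of_subset hF.1
    have h₂ : (U \ F) ∩ A = A \ F := by
      ext x
      have := @hA x
      simp only [mem_sdiff, mem_inter]
      tauto
    have h₃ := card_inter_add_card_sdiff A F
    rw [inter_comm] at h₃
    refine ⟨mem_powersetCard.2 ⟨sdiff_subset, by omega⟩, Finset.sdiff_sdiff_eq_self hF.1, ?_⟩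
    rw [h₂]
    omega
  refine card_bij' (fun F _ => U \ F) (fun F _ => U \ F) ?_ ?_ ?_ ?_ <;> intro F hF <;>
    rw [mem_filter] at hF <;> obtain ⟨h₁, h₂, h₃⟩ := key F hF.1
  · exact mem_filter.2 ⟨h₁, by omega⟩
  · exact mem_filter.2 ⟨h₁, by omega⟩
  · exact h₂
  · exact h₂

open Finset in
/-- `card_filter_powersetCard_inter` with an integer trace size. -/
theorem card_filter_powersetCard_inter_int {α : Type*} [DecidableEq α] {U A : Finset α}
    (hA : A ⊆ U) (m : ℕ) {k : ℤ} (hk : 0 ≤ k) :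
    ((powersetCard m U).filter fun F => ((F ∩ A).card : ℤ) = k).card =
      chooseZ A.card k * chooseZ (U.card - A.card) (m - k) := by
  lift k to ℕ using hk
  simp only [Nat.cast_inj, chooseZ, Nat.cast_nonneg, if_true, Int.toNat_natCast]
  by_cases hkm : k ≤ m
  · rw [card_filter_powersetCard_inter hA hkm, if_pos (by omega)]
    congr 2
    omega
  · rw [if_neg (by omega), mul_zero, card_eq_zero, filter_eq_empty_iff]
    intro F hF h
    have := card_le_card (inter_subset_left (s₁ := F) (s₂ := A))
    rw [mem_powersetCard] at hF
    omega

theorem stmt_3 (m s i : ℕ) (hs : 1 ≤ s) (hsi : s + i ≤ m) :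
    ((Fam (2 * m) m (2 * s) i).card : ℚ) =
      (1 / 2) * ((Nat.choose (2 * m) m : ℚ) -
        ∑ j ∈ Finset.Icc (1 - (s : ℤ)) ((s : ℤ) - 1),
          ((chooseZ (2 * (s + i)) ((s : ℤ) + i + j) : ℚ) *
            (chooseZ (2 * m - 2 * (s + i)) ((m : ℤ) - ((s : ℤ) + i + j)) : ℚ))) := by
  set U := Finset.Icc 1 (2 * m) with hUdef
  set A := Finset.Icc 1 (2 * s + 2 * i) with hAdef
  have hU : U.card = 2 * m := by simp [hUdef]
  have hAc : A.card = 2 * (s + i) := by simp [hAdef]; ring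
  have hA : A ⊆ U := Finset.Icc_subset_Icc le_rfl (by omega)
  set X := Finset.powersetCard m U with hX
  have hXc : X.card = (2 * m).choose m := by rw [hX, Finset.card_powersetCard, hU]
  have hFam : Fam (2 * m) m (2 * s) i = X.filter fun F => 2 * s + i ≤ (F ∩ A).card := by
    ext F
    simp only [Fam, hX, Finset.mem_filter, Finset.mem_powerset, Finset.mem_powersetCard, and_assoc,
      ← hUdef, ← hAdef]
  have hlow := card_filter_le_card_inter_eq (k := i) (l := 2 * s + i) hA hU (by omega)
  set M := X.filter fun F => i < (F ∩ A).card ∧ (F ∩ A).card < 2 * s + i with hM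
  have hsplit : X.card = (X.filter fun F => (F ∩ A).card ≤ i).card + M.card +
      (X.filter fun F => 2 * s + i ≤ (F ∩ A).card).card := by
    rw [Finset.card_eq_sum_ones X]
    simp only [hM, Finset.card_filter, ← Finset.sum_add_distrib]
    refine Finset.sum_congr rfl fun F _ => ?_
    split_ifs <;> omega
  have hmid : M.card = ∑ j ∈ Finset.Icc (1 - (s : ℤ)) ((s : ℤ) - 1),
      chooseZ (2 * (s + i)) ((s : ℤ) + i + j) *
        chooseZ (2 * m - 2 * (s + i)) ((m : ℤ) - ((s : ℤ) + i + j)) := by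
    rw [Finset.card_eq_sum_card_fiberwise (f := fun F => ((F ∩ A).card : ℤ) - (s + i))
      (t := Finset.Icc (1 - (s : ℤ)) ((s : ℤ) - 1))]
    · refine Finset.sum_congr rfl fun j hj => ?_
      rw [Finset.mem_Icc] at hj
      rw [← hAc, ← hU, ← card_filter_powersetCard_inter_int hA m (by omega), hM,
        Finset.filter_filter]
      congr 1
      refine Finset.filter_congr fun F _ => ?_
      omega
    · intro F hF
      simp only [hM, Finset.coe_filter, Set.mem_ofPred_eq, Finset.coe_Icc, Set.mem_Icc] at hF ⊢
      omega
  have htotal : ((2 * m).choose m : ℚ) = 2 * (Fam (2 * m) m (2 * s) i).card + M.card := by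
    rw [← hX] at hlow
    rw [← hXc, hsplit, hlow, hFam]
    push_cast
    ring
  rw [htotal, hmid]
  push_cast
  ring
end

section
/- For all 1 ≤ t ≤ k ≤ m ≤ n and all 0 ≤ i ≤ min(k−t, (n−t)/2), the m-shade of F_i(n,k,t) with respect to S = [n] equals F_i(n,m,t), i.e., ∇^m(F_i(n,k,t)) = F_i(n,m,t). -/
/-- The m-shade of `x` with respect to the ground set `S`:
all subsets `y` of `S` with `x ⊆ y` and `|y| = m`. -/
def shade (S : Finset ℕ) (m : ℕ) (x : Finset ℕ) : Finset (Finset ℕ) :=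
  S.powerset.filter fun y => x ⊆ y ∧ y.card = m

/-- The m-shade of a family `X` with respect to the ground set `S`. -/
def shadeFam (S : Finset ℕ) (m : ℕ) (X : Finset (Finset ℕ)) : Finset (Finset ℕ) :=
  X.biUnion (shade S m)

theorem stmt_7 (n m k t i : ℕ) (ht : 1 ≤ t) (htk : t ≤ k) (hkm : k ≤ m) (hmn : m ≤ n)
    (hi1 : i ≤ k - t) (hi2 : i ≤ (n - t) / 2) :
    shadeFam (Finset.Icc 1 n) m (Fam n k t i) = Fam n m t i := by
  ext y
  simp only [shadeFam, shade, Fam, Finset.mem_biUnion, Finset.mem_filter, Finset.mem_powerset]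
  constructor
  · rintro ⟨x, ⟨-, -, hx⟩, hyn, hxy, hym⟩
    exact ⟨hyn, hym, hx.trans (Finset.card_le_card (Finset.inter_subset_inter_right hxy))⟩
  · rintro ⟨hyn, hym, hy⟩
    obtain ⟨a, ha, hat⟩ := Finset.exists_subset_card_eq hy
    obtain ⟨hay, haI⟩ := Finset.subset_inter_iff.mp ha
    obtain ⟨x, hax, hxy, hxk⟩ :=
      Finset.exists_subsuperset_card_eq hay (n := k) (by omega) (by omega)
    refine ⟨x, ⟨hxy.trans hyn, hxk, ?_⟩, hyn, hxy, hym⟩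
    exact hat.ge.trans (Finset.card_le_card (Finset.subset_inter hax haI))
end

section
/- Liminf as m → ∞ of M_0(4m, 2m, 2m, 2) / C(4m, 2m) is at least 1/2. -/
/-- A family is `t`-intersecting if any two members meet in at least `t` elements. -/
def IsTIntersecting (t : ℕ) (A : Finset (Finset ℕ)) : Prop :=
  ∀ E ∈ A, ∀ F ∈ A, t ≤ (E ∩ F).card

/-- `M0 n m k t`: maximum cardinality of the m-shade (w.r.t. [n]) of a
t-intersecting family of k-subsets of [n]. -/
noncomputable def M0 (n m k t : ℕ) : ℕ :=
  sSup {r | ∃ A : Finset (Finset ℕ), (∀ F ∈ A, F ⊆ Finset.Icc 1 n ∧ F.card = k) ∧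
    IsTIntersecting t A ∧ r = (shadeFam (Finset.Icc 1 n) m A).card}

open Finset in
theorem shadeFam_self {S : Finset ℕ} {k : ℕ} {A : Finset (Finset ℕ)}
    (hA : A ⊆ powersetCard k S) : shadeFam S k A = A := by
  ext y
  simp only [shadeFam, shade, mem_biUnion, mem_filter, mem_powerset]
  constructor
  · rintro ⟨x, hx, -, hxy, hy⟩
    rwa [← eq_of_subset_of_card_le hxy (by rw [hy, (mem_powersetCard.1 (hA hx)).2])]
  · intro hy
    have := mem_powersetCard.1 (hA hy)
    exact ⟨y, hy, this.1, Subset.rfl, this.2⟩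

open Finset in
theorem shadeFam_subset_powersetCard (S : Finset ℕ) (m : ℕ) (A : Finset (Finset ℕ)) :
    shadeFam S m A ⊆ powersetCard m S := by
  intro y
  simp only [shadeFam, shade, mem_biUnion, mem_filter, mem_powerset, mem_powersetCard]
  rintro ⟨x, -, hy, -, hc⟩
  exact ⟨hy, hc⟩

open Finset in
theorem card_shadeFam_Icc_le (n m : ℕ) (A : Finset (Finset ℕ)) :
    (shadeFam (Icc 1 n) m A).card ≤ n.choose m := by
  simpa using card_le_card (shadeFam_subset_powersetCard (Icc 1 n) m A)

theorem M0_le_choose (n m k t : ℕ) : M0 n m k t ≤ n.choose m := by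
  refine csSup_le' ?_
  rintro r ⟨A, -, -, rfl⟩
  exact card_shadeFam_Icc_le n m A

open Finset in
theorem card_le_M0 {n k t : ℕ} {A : Finset (Finset ℕ)} (hA : A ⊆ powersetCard k (Icc 1 n))
    (ht : IsTIntersecting t A) : A.card ≤ M0 n k k t := by
  refine le_csSup ⟨n.choose k, ?_⟩ ⟨A, fun F hF => mem_powersetCard.1 (hA hF), ht, ?_⟩
  · rintro r ⟨A, -, -, rfl⟩
    exact card_shadeFam_Icc_le n k A
  · rw [shadeFam_self hA]

/-- Two sets that each contain more than half of `T`, where `|T|` is even, share at least two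
elements. -/
theorem isTIntersecting_two_of_half_lt {m : ℕ} {T : Finset ℕ} (hT : T.card = 2 * m)
    {A : Finset (Finset ℕ)} (hA : ∀ F ∈ A, m < (F ∩ T).card) : IsTIntersecting 2 A := by
  intro E hE F hF
  have hunion : ((E ∩ T) ∪ (F ∩ T)).card ≤ T.card :=
    Finset.card_le_card (Finset.union_subset Finset.inter_subset_right Finset.inter_subset_right)
  have hinter : ((E ∩ T) ∩ (F ∩ T)).card ≤ (E ∩ F).card :=
    Finset.card_le_card
      (Finset.inter_subset_inter Finset.inter_subset_left Finset.inter_subset_left)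
  have := Finset.card_union_add_card_inter (E ∩ T) (F ∩ T)
  have := hA E hE
  have := hA F hF
  omega

open Finset in
/-- Complementation in `S` exchanges the sets containing less than half of `T` with those
containing more than half of it. -/
theorem card_filter_inter_lt_le {m : ℕ} {S T : Finset ℕ} (hTS : T ⊆ S) (hS : S.card = 4 * m)
    (hT : T.card = 2 * m) :
    ((powersetCard (2 * m) S).filter fun F => (F ∩ T).card < m).card ≤
      ((powersetCard (2 * m) S).filter fun F => m < (F ∩ T).card).card := by
  refine card_le_card_of_injOn (fun F => S \ F) ?_ ?_
  · intro F hF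
    simp only [coe_filter, mem_powersetCard, Set.mem_ofPred_eq] at hF ⊢
    obtain ⟨⟨hFS, hF⟩, hlt⟩ := hF
    have hsdiff : (S \ F) ∩ T = T \ F := by grind
    have := card_sdiff_add_card_inter T F
    rw [inter_comm T F] at this
    refine ⟨⟨sdiff_subset, ?_⟩, ?_⟩
    · rw [card_sdiff_of_subset hFS]; omega
    · rw [hsdiff]; omega
  · intro F hF G hG h
    simp only [coe_filter, mem_powersetCard, Set.mem_ofPred_eq] at hF hG
    rw [← Finset.sdiff_sdiff_eq_self hF.1.1, ← Finset.sdiff_sdiff_eq_self hG.1.1]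
    exact congrArg (S \ ·) h

open Finset in
theorem card_filter_inter_eq_le {m : ℕ} {S T : Finset ℕ} (hTS : T ⊆ S) (hS : S.card = 4 * m)
    (hT : T.card = 2 * m) :
    ((powersetCard (2 * m) S).filter fun F => (F ∩ T).card = m).card ≤ m.centralBinom ^ 2 := by
  have hcard : (powersetCard m T ×ˢ powersetCard m (S \ T)).card = m.centralBinom ^ 2 := by
    rw [card_product, card_powersetCard, card_powersetCard, card_sdiff_of_subset hTS, hS, hT,
      show 4 * m - 2 * m = 2 * m by omega, Nat.centralBinom, sq]
  rw [← hcard]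
  refine card_le_card_of_injOn (fun F => (F ∩ T, F \ T)) ?_ ?_
  · intro F hF
    simp only [coe_filter, mem_powersetCard, Set.mem_ofPred_eq] at hF
    obtain ⟨⟨hFS, hF⟩, heq⟩ := hF
    have := card_sdiff_add_card_inter F T
    simp only [coe_product, Set.mem_prod, mem_coe, mem_powersetCard]
    exact ⟨⟨inter_subset_right, heq⟩, sdiff_subset_sdiff hFS Subset.rfl, by omega⟩
  · intro F _ G _ h
    simp only [Prod.mk.injEq] at h
    rw [← sdiff_union_inter F T, ← sdiff_union_inter G T, h.1, h.2]

open Finset in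
theorem centralBinom_two_mul_le_M0 (m : ℕ) :
    (2 * m).centralBinom ≤ 2 * M0 (4 * m) (2 * m) (2 * m) 2 + m.centralBinom ^ 2 := by
  have hTS : Icc 1 (2 * m) ⊆ Icc 1 (4 * m) := Icc_subset_Icc le_rfl (by omega)
  have hS : (Icc 1 (4 * m)).card = 4 * m := by simp
  have hT : (Icc 1 (2 * m)).card = 2 * m := by simp
  set P := powersetCard (2 * m) (Icc 1 (4 * m)) with hP
  have hM := card_le_M0 (t := 2) (filter_subset (fun F => m < (F ∩ Icc 1 (2 * m)).card) P)
    (isTIntersecting_two_of_half_lt hT fun F hF => (mem_filter.1 hF).2)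
  have hlt := card_filter_inter_lt_le hTS hS hT
  have heq := card_filter_inter_eq_le hTS hS hT
  rw [← hP] at hlt heq
  have hPcard : P.card = (2 * m).centralBinom := by
    rw [hP, card_powersetCard, hS, Nat.centralBinom, show 2 * (2 * m) = 4 * m by ring]
  have hcover : P ⊆ (P.filter fun F => m < (F ∩ Icc 1 (2 * m)).card) ∪
      ((P.filter fun F => (F ∩ Icc 1 (2 * m)).card < m) ∪
        P.filter fun F => (F ∩ Icc 1 (2 * m)).card = m) := by
    intro F hF
    simp only [mem_union, mem_filter, hF, true_and]
    omega
  have := (card_le_card hcover).trans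
    ((card_union_le _ _).trans (Nat.add_le_add_left (card_union_le _ _) _))
  omega

theorem centralBinom_sq_mul_le (m : ℕ) : m.centralBinom ^ 2 * (2 * m + 1) ≤ 16 ^ m := by
  induction m with
  | zero => simp
  | succ m ih =>
    have h := Nat.succ_mul_centralBinom_succ m
    refine Nat.le_of_mul_le_mul_left (c := (m + 1) ^ 2) ?_ (by positivity)
    calc (m + 1) ^ 2 * ((m + 1).centralBinom ^ 2 * (2 * (m + 1) + 1))
        = ((m + 1) * (m + 1).centralBinom) ^ 2 * (2 * m + 3) := by ring
      _ = (m.centralBinom ^ 2 * (2 * m + 1)) * (4 * (2 * m + 1) * (2 * m + 3)) := by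
        rw [h]; ring
      _ ≤ 16 ^ m * (16 * (m + 1) ^ 2) := Nat.mul_le_mul ih (by nlinarith)
      _ = (m + 1) ^ 2 * 16 ^ (m + 1) := by ring

theorem pow_le_mul_centralBinom_sq {m : ℕ} (hm : 1 ≤ m) :
    16 ^ m ≤ 4 * m * m.centralBinom ^ 2 := by
  induction m, hm using Nat.le_induction with
  | base => simp [Nat.centralBinom, Nat.choose]
  | succ m hm ih =>
    have h := Nat.succ_mul_centralBinom_succ m
    refine Nat.le_of_mul_le_mul_left (c := m + 1) ?_ (by positivity)
    calc (m + 1) * 16 ^ (m + 1) = 16 ^ m * (16 * (m + 1)) := by ring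
      _ ≤ (4 * m * m.centralBinom ^ 2) * (16 * (m + 1)) := Nat.mul_le_mul_right _ ih
      _ = (16 * m.centralBinom ^ 2) * (4 * m * (m + 1)) := by ring
      _ ≤ (16 * m.centralBinom ^ 2) * (2 * m + 1) ^ 2 := Nat.mul_le_mul_left _ (by nlinarith)
      _ = 4 * (2 * (2 * m + 1) * m.centralBinom) ^ 2 := by ring
      _ = (m + 1) * (4 * (m + 1) * (m + 1).centralBinom ^ 2) := by rw [← h]; ring

theorem centralBinom_sq_div_sq_le {m : ℕ} (hm : 1 ≤ m) :
    ((m.centralBinom : ℝ) ^ 2 / (2 * m).centralBinom) ^ 2 ≤ 4 / m := by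
  have hupper := Nat.pow_le_pow_left (centralBinom_sq_mul_le m) 2
  have hlower := pow_le_mul_centralBinom_sq (show 1 ≤ 2 * m by omega)
  have hpow : (16 ^ m) ^ 2 = 16 ^ (2 * m) := by rw [← pow_mul, mul_comm]
  have hle : m.centralBinom ^ 4 * (2 * m + 1) ^ 2 ≤ 8 * m * (2 * m).centralBinom ^ 2 := by
    calc _ = (m.centralBinom ^ 2 * (2 * m + 1)) ^ 2 := by ring
      _ ≤ _ := (hupper.trans_eq hpow).trans hlower
      _ = _ := by ring
  have hmul : m.centralBinom ^ 4 * m ≤ 4 * (2 * m).centralBinom ^ 2 := by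
    refine Nat.le_of_mul_le_mul_left (c := 2 * m) ?_ (by omega)
    calc _ = m.centralBinom ^ 4 * (2 * m ^ 2) := by ring
      _ ≤ m.centralBinom ^ 4 * (2 * m + 1) ^ 2 := Nat.mul_le_mul_left _ (by nlinarith)
      _ ≤ _ := hle
      _ = _ := by ring
  have hpos : (0 : ℝ) < (2 * m).centralBinom := by exact_mod_cast Nat.centralBinom_pos _
  have hm' : (0 : ℝ) < m := by exact_mod_cast hm
  rw [div_pow, ← pow_mul, div_le_div_iff₀ (by positivity) hm']
  exact_mod_cast hmul

open Filter Topology in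
theorem tendsto_centralBinom_sq_div :
    Tendsto (fun m : ℕ => (m.centralBinom : ℝ) ^ 2 / (2 * m).centralBinom) atTop (𝓝 0) := by
  have hsq : Tendsto (fun m : ℕ => ((m.centralBinom : ℝ) ^ 2 / (2 * m).centralBinom) ^ 2)
      atTop (𝓝 0) :=
    squeeze_zero' (Eventually.of_forall fun m => sq_nonneg _)
      ((eventually_ge_atTop 1).mono fun m hm => centralBinom_sq_div_sq_le hm)
      (tendsto_const_div_atTop_nhds_zero_nat 4)
  have hsqrt := hsq.sqrt
  rw [Real.sqrt_zero] at hsqrt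
  exact hsqrt.congr fun m => Real.sqrt_sq (by positivity)

open Filter in
theorem stmt_10 :
    (1 : ℝ) / 2 ≤
      Filter.liminf
        (fun m : ℕ => ((M0 (4 * m) (2 * m) (2 * m) 2 : ℝ) / (Nat.choose (4 * m) (2 * m) : ℝ)))
        atTop := by
  have hlim := (tendsto_centralBinom_sq_div.const_sub 1).div_const 2
  rw [sub_zero] at hlim
  rw [← hlim.liminf_eq]
  refine liminf_le_liminf (Eventually.of_forall fun m => ?_) hlim.isBoundedUnder_ge
    (isBoundedUnder_of ⟨1, fun m => ?_⟩).isCoboundedUnder_ge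
  · have hchoose : (4 * m).choose (2 * m) = (2 * m).centralBinom := by
      rw [Nat.centralBinom, show 2 * (2 * m) = 4 * m by ring]
    have hpos : (0 : ℝ) < (2 * m).centralBinom := by exact_mod_cast Nat.centralBinom_pos _
    have hM : ((2 * m).centralBinom : ℝ) ≤
        2 * M0 (4 * m) (2 * m) (2 * m) 2 + (m.centralBinom : ℝ) ^ 2 := by
      exact_mod_cast centralBinom_two_mul_le_M0 m
    rw [hchoose, one_sub_div hpos.ne', div_right_comm]
    gcongr
    linarith
  · exact div_le_one_of_le₀ (by exact_mod_cast M0_le_choose _ _ _ _) (by positivity)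
end

section
/- Let k : ℕ → ℕ satisfy k(n) = o(n) and lim_{n→∞} k(n) = ∞, and let a, b ≥ 0. Then lim_{n→∞} Σ_{j=−⌊a√(k(n)/2)⌋}^{⌊b√(k(n)/2)⌋} C(2k(n), k(n)+j) · C(2(n−k(n)), (n−k(n))−j) / C(2n, n) = Φ(b) − Φ(−a). -/
/-- The standard normal cumulative distribution function. -/
noncomputable def Phi (t : ℝ) : ℝ :=
  (Real.sqrt (2 * Real.pi))⁻¹ * ∫ x in Set.Iic t, Real.exp (-x ^ 2 / 2)

open Filter Topology MeasureTheory

theorem chooseZ_two_mul_add (k : ℕ) (j : ℤ) :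
    chooseZ (2 * k) ((k : ℤ) + j) = (2 * k).choose (k + j.natAbs) := by
  unfold chooseZ
  rcases le_total 0 j with hj | hj
  · rw [if_pos (by omega)]
    congr 1
    omega
  · split_ifs with h
    · rw [← Nat.choose_symm (by omega : k + j.natAbs ≤ 2 * k)]
      congr 1
      omega
    · rw [Nat.choose_eq_zero_of_lt (by omega)]

/-- The ratio of `C(2k, k + i)` to the central binomial coefficient `C(2k, k)`. -/
noncomputable def centralRatio (k i : ℕ) : ℝ :=
  ((2 * k).choose (k + i) : ℝ) / (k.centralBinom : ℝ)

theorem centralBinom_cast_pos (k : ℕ) : (0 : ℝ) < k.centralBinom := by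
  exact_mod_cast k.centralBinom_pos

theorem choose_two_mul_eq (k i : ℕ) :
    ((2 * k).choose (k + i) : ℝ) = k.centralBinom * centralRatio k i := by
  have := (centralBinom_cast_pos k).ne'
  unfold centralRatio
  field_simp

theorem centralRatio_nonneg (k i : ℕ) : 0 ≤ centralRatio k i := by
  unfold centralRatio
  positivity

theorem centralRatio_le_one (k i : ℕ) : centralRatio k i ≤ 1 := by
  unfold centralRatio
  rw [div_le_one (centralBinom_cast_pos k)]
  exact_mod_cast Nat.choose_le_centralBinom _ _

theorem centralRatio_zero (k : ℕ) : centralRatio k 0 = 1 := by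
  unfold centralRatio
  rw [add_zero, ← Nat.centralBinom_eq_two_mul_choose]
  exact div_self (centralBinom_cast_pos k).ne'

theorem centralRatio_succ {k i : ℕ} (h : i ≤ k) :
    centralRatio k (i + 1) = centralRatio k i * (((k : ℝ) - i) / (k + i + 1)) := by
  have h1 := Nat.choose_succ_right_eq (2 * k) (k + i)
  rw [show 2 * k - (k + i) = k - i by omega] at h1
  have h2 : ((2 * k).choose (k + i + 1) : ℝ) * (k + i + 1)
      = (2 * k).choose (k + i) * ((k : ℝ) - i) := by
    rw [← Nat.cast_sub h]
    exact_mod_cast h1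
  have := (centralBinom_cast_pos k).ne'
  have h3 : (k : ℝ) + i + 1 ≠ 0 := by positivity
  unfold centralRatio
  rw [← add_assoc]
  field_simp
  linarith

theorem centralRatio_le_exp {k J : ℕ} (hJ : J < k) {i : ℕ} (hi : i ≤ J) :
    centralRatio k i ≤ Real.exp (-((i : ℝ) ^ 2 / (k + J))) := by
  induction i with
  | zero => simp [centralRatio_zero]
  | succ i ih =>
    have hiJ : (i : ℝ) + 1 ≤ J := by exact_mod_cast hi
    have hJk : (J : ℝ) < k := by exact_mod_cast hJ
    have hi0 : (0 : ℝ) ≤ i := by positivity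
    rw [centralRatio_succ (by omega)]
    have hstep : ((k : ℝ) - i) / (k + i + 1) ≤ Real.exp (-((2 * i + 1 : ℝ) / (k + J))) := by
      have h1 : ((k : ℝ) - i) / (k + i + 1) = -((2 * i + 1 : ℝ) / (k + i + 1)) + 1 := by
        have : (k : ℝ) + i + 1 ≠ 0 := by linarith
        field_simp
        ring
      have h2 : (2 * i + 1 : ℝ) / (k + J) ≤ (2 * i + 1 : ℝ) / (k + i + 1) :=
        div_le_div_of_nonneg_left (by linarith) (by linarith) (by linarith)
      have := Real.add_one_le_exp (-((2 * i + 1 : ℝ) / (k + J)))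
      linarith
    calc _ ≤ Real.exp (-((i : ℝ) ^ 2 / (k + J))) * Real.exp (-((2 * i + 1 : ℝ) / (k + J))) :=
          mul_le_mul (ih (by omega)) hstep
            (div_nonneg (by linarith) (by linarith)) (Real.exp_nonneg _)
      _ = _ := by
          rw [← Real.exp_add]
          congr 1
          push_cast
          ring

theorem exp_le_centralRatio {k J : ℕ} (hJ : J < k) {i : ℕ} (hi : i ≤ J) :
    Real.exp (-((i : ℝ) ^ 2 / (k - J))) ≤ centralRatio k i := by
  induction i with
  | zero => simp [centralRatio_zero]
  | succ i ih =>
    have hiJ : (i : ℝ) + 1 ≤ J := by exact_mod_cast hi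
    have hJk : (J : ℝ) < k := by exact_mod_cast hJ
    have hi0 : (0 : ℝ) ≤ i := by positivity
    rw [centralRatio_succ (by omega)]
    have hstep : Real.exp (-((2 * i + 1 : ℝ) / (k - J))) ≤ ((k : ℝ) - i) / (k + i + 1) := by
      have h1 : ((k : ℝ) + i + 1) / (k - i) = (2 * i + 1 : ℝ) / (k - i) + 1 := by
        have : (k : ℝ) - i ≠ 0 := by linarith
        field_simp
        ring
      have h2 : (2 * i + 1 : ℝ) / (k - i) ≤ (2 * i + 1 : ℝ) / (k - J) :=
        div_le_div_of_nonneg_left (by linarith) (by linarith) (by linarith)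
      have h3 := Real.add_one_le_exp ((2 * i + 1 : ℝ) / (k - J))
      rw [Real.exp_neg, ← inv_div ((k : ℝ) + i + 1) (k - i)]
      exact inv_anti₀ (div_pos (by linarith) (by linarith)) (by linarith)
    calc _ = Real.exp (-((i : ℝ) ^ 2 / (k - J))) * Real.exp (-((2 * i + 1 : ℝ) / (k - J))) := by
          rw [← Real.exp_add]
          congr 1
          push_cast
          ring
      _ ≤ _ := mul_le_mul (ih (by omega)) hstep (Real.exp_nonneg _) (centralRatio_nonneg _ _)

/-- Local limit for off-centre binomial coefficients: if `J² / K → c` and `K → ∞`, then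
`C(2K, K + J) / C(2K, K) → exp (-c)`. -/
theorem tendsto_centralRatio {ι : Type*} {l : Filter ι} {K J : ι → ℕ} {c : ℝ}
    (hK : Tendsto K l atTop) (hJ : Tendsto (fun n => (J n : ℝ) ^ 2 / K n) l (𝓝 c)) :
    Tendsto (fun n => centralRatio (K n) (J n)) l (𝓝 (Real.exp (-c))) := by
  have hK' : Tendsto (fun n => (K n : ℝ)) l atTop := tendsto_natCast_atTop_atTop.comp hK
  have hpos : ∀ᶠ n in l, (0 : ℝ) < K n := hK'.eventually_gt_atTop 0
  have hq : Tendsto (fun n => (J n : ℝ) / K n) l (𝓝 0) := by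
    have h1 : Tendsto (fun n => √((J n : ℝ) ^ 2 / K n * (K n : ℝ)⁻¹)) l (𝓝 √(c * 0)) :=
      (hJ.mul (tendsto_inv_atTop_zero.comp hK')).sqrt
    rw [mul_zero, Real.sqrt_zero] at h1
    refine h1.congr fun n => ?_
    rw [← Real.sqrt_sq (by positivity : (0 : ℝ) ≤ (J n : ℝ) / K n)]
    congr 1
    ring
  have hlt : ∀ᶠ n in l, J n < K n := by
    filter_upwards [hpos, hq.eventually_lt_const one_pos] with n h0 h1
    rw [div_lt_one h0] at h1
    exact_mod_cast h1
  have hlow : Tendsto (fun n => Real.exp (-((J n : ℝ) ^ 2 / (K n - J n)))) l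
      (𝓝 (Real.exp (-c))) := by
    have h1 := (hJ.div (tendsto_const_nhds.sub hq) (by norm_num : (1 : ℝ) - 0 ≠ 0)).neg.rexp
    rw [sub_zero, div_one] at h1
    refine h1.congr' ?_
    filter_upwards [hpos] with n h0
    simp only [Pi.div_apply]
    rw [one_sub_div h0.ne', div_div_div_cancel_right₀ h0.ne']
  have hup : Tendsto (fun n => Real.exp (-((J n : ℝ) ^ 2 / (K n + J n)))) l
      (𝓝 (Real.exp (-c))) := by
    have h1 := (hJ.div (tendsto_const_nhds.add hq) (by norm_num : (1 : ℝ) + 0 ≠ 0)).neg.rexp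
    rw [add_zero, div_one] at h1
    refine h1.congr' ?_
    filter_upwards [hpos] with n h0
    simp only [Pi.div_apply]
    rw [one_add_div h0.ne', div_div_div_cancel_right₀ h0.ne']
  refine tendsto_of_tendsto_of_tendsto_of_le_of_le' hlow hup ?_ ?_
  · filter_upwards [hlt] with n hn using exp_le_centralRatio hn le_rfl
  · filter_upwards [hlt] with n hn using centralRatio_le_exp hn le_rfl

theorem tendsto_centralBinom_mul_sqrt_div :
    Tendsto (fun n : ℕ => (n.centralBinom : ℝ) * √n / 4 ^ n) atTop (𝓝 (√Real.pi)⁻¹) := by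
  have hs := Stirling.tendsto_stirlingSeq_sqrt_pi
  have hs2 := hs.comp (tendsto_id.const_mul_atTop' (by norm_num : 0 < 2))
  have hpi : (0 : ℝ) < √Real.pi := Real.sqrt_pos.2 Real.pi_pos
  have h := hs2.div (hs.pow 2) (by positivity)
  rw [show √Real.pi / √Real.pi ^ 2 = (√Real.pi)⁻¹ by field_simp] at h
  refine h.congr' ?_
  filter_upwards [eventually_gt_atTop 0] with n hn
  have hn' : (0 : ℝ) < n := by exact_mod_cast hn
  have hc : (n.centralBinom : ℝ) * ((n.factorial : ℝ)) ^ 2 = (2 * n).factorial := by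
    have := Nat.choose_mul_factorial_mul_factorial (by omega : n ≤ 2 * n)
    rw [show 2 * n - n = n by omega, ← Nat.centralBinom_eq_two_mul_choose] at this
    rw [← this]
    push_cast
    ring
  have hf : (0 : ℝ) < n.factorial := by exact_mod_cast n.factorial_pos
  have hsq : √(2 * ((2 * n : ℕ) : ℝ)) = 2 * √n := by
    rw [show (2 * ((2 * n : ℕ) : ℝ)) = 2 ^ 2 * n by push_cast; ring,
      Real.sqrt_mul (by norm_num), Real.sqrt_sq (by norm_num)]
  have hn2 : √(n : ℝ) ^ 2 = n := Real.sq_sqrt hn'.le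
  have hn3 : √(2 * (n : ℝ)) ^ 2 = 2 * n := Real.sq_sqrt (by positivity)
  have hp : (((2 * n : ℕ) : ℝ) / Real.exp 1) ^ (2 * n)
      = 4 ^ n * (((n : ℝ) / Real.exp 1) ^ n) ^ 2 := by
    rw [pow_mul, ← pow_mul _ n 2, mul_comm n 2, pow_mul _ 2 n, ← mul_pow]
    congr 1
    push_cast
    ring
  simp only [Function.comp, Pi.div_apply, id, Stirling.stirlingSeq]
  rw [hsq, hp, ← hc]
  have hsn : (0 : ℝ) < √n := Real.sqrt_pos.2 hn'
  have hX : (0 : ℝ) < ((n : ℝ) / Real.exp 1) ^ n := by positivity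
  generalize ((n : ℝ) / Real.exp 1) ^ n = X at hX ⊢
  rw [div_pow, mul_pow, hn3]
  field_simp
  rw [hn2]

/-- The size of the central term of the Vandermonde sum. -/
theorem tendsto_sqrt_mul_centralBinom {k : ℕ → ℕ}
    (hko : Tendsto (fun n : ℕ => (k n : ℝ) / n) atTop (𝓝 0))
    (hki : Tendsto k atTop atTop) (hlt : ∀ᶠ n in atTop, k n < n)
    (hm : Tendsto (fun n => n - k n) atTop atTop) :
    Tendsto (fun n => √((k n : ℝ) / 2) *
      (((k n).centralBinom : ℝ) * (n - k n).centralBinom / n.centralBinom)) atTop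
      (𝓝 (√(2 * Real.pi))⁻¹) := by
  have hc := tendsto_centralBinom_mul_sqrt_div
  have hpi : (0 : ℝ) < √Real.pi := Real.sqrt_pos.2 Real.pi_pos
  have hr : Tendsto (fun n => √((1 - (k n : ℝ) / n)⁻¹ / 2)) atTop (𝓝 √((1 - 0)⁻¹ / 2)) :=
    (((tendsto_const_nhds.sub hko).inv₀ (by norm_num)).div_const 2).sqrt
  have h := (((hc.comp hki).mul (hc.comp hm)).div hc (by positivity)).mul hr
  have hlim : (√Real.pi)⁻¹ * (√Real.pi)⁻¹ / (√Real.pi)⁻¹ * √((1 - 0)⁻¹ / 2)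
      = (√(2 * Real.pi))⁻¹ := by
    rw [sub_zero, inv_one, one_div, Real.sqrt_inv, Real.sqrt_mul (by norm_num), mul_inv]
    field_simp
  rw [hlim] at h
  refine h.congr' ?_
  filter_upwards [hlt, hki.eventually_gt_atTop 0] with n hn hk
  have hk' : (0 : ℝ) < k n := by exact_mod_cast hk
  have hn' : (0 : ℝ) < n := by exact_mod_cast (by omega : 0 < n)
  have hm' : (0 : ℝ) < (n - k n : ℕ) := by exact_mod_cast (by omega : 0 < n - k n)
  have hcast : (n : ℝ) - k n = (n - k n : ℕ) := by rw [Nat.cast_sub hn.le]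
  rw [one_sub_div hn'.ne', inv_div, hcast]
  simp only [Function.comp, Pi.div_apply]
  have hpow : (4 : ℝ) ^ n = 4 ^ k n * 4 ^ (n - k n) := by
    rw [← pow_add]
    congr 1
    omega
  rw [hpow, Real.sqrt_div (by positivity), Real.sqrt_div (by positivity),
    Real.sqrt_div (by positivity)]
  have := centralBinom_cast_pos n
  have h1 := Real.sqrt_pos.2 hk'
  have h2 := Real.sqrt_pos.2 hn'
  have h3 := Real.sqrt_pos.2 hm'
  field_simp

theorem tendsto_floor_mul_div {ι : Type*} {l : Filter ι} {s : ι → ℝ} (hs : Tendsto s l atTop)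
    (x : ℝ) : Tendsto (fun n => (⌊x * s n⌋ : ℝ) / s n) l (𝓝 x) := by
  have h1 : Tendsto (fun n => x - (s n)⁻¹) l (𝓝 (x - 0)) :=
    tendsto_const_nhds.sub (tendsto_inv_atTop_zero.comp hs)
  rw [sub_zero] at h1
  refine tendsto_of_tendsto_of_tendsto_of_le_of_le' h1 tendsto_const_nhds ?_ ?_
  · filter_upwards [hs.eventually_gt_atTop 0] with n hn
    rw [le_div_iff₀ hn, sub_mul, inv_mul_cancel₀ hn.ne']
    linarith [Int.lt_floor_add_one (x * s n)]
  · filter_upwards [hs.eventually_gt_atTop 0] with n hn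
    rw [div_le_iff₀ hn]
    exact Int.floor_le _

theorem integral_ite_floor_mul_eq {s : ℝ} (hs : 0 < s) (j : ℤ) (c : ℝ) :
    Integrable (fun x : ℝ => if ⌊x * s⌋ = j then c else 0) ∧
      ∫ x : ℝ, (if ⌊x * s⌋ = j then c else 0) = c / s := by
  have h : (fun x : ℝ => if ⌊x * s⌋ = j then c else 0)
      = (Set.Ico ((j : ℝ) / s) ((j + 1) / s)).indicator (fun _ => c) := by
    funext x
    rw [Set.indicator_apply]
    congr 1
    rw [Int.floor_eq_iff, Set.mem_Ico, div_le_iff₀ hs, lt_div_iff₀ hs]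
  rw [h]
  constructor
  · rw [integrable_indicator_iff measurableSet_Ico]
    exact integrableOn_const (by simp)
  · rw [integral_indicator_const _ measurableSet_Ico, Real.volume_real_Ico_of_le (by gcongr; simp)]
    simp only [smul_eq_mul]
    ring

/-- A finite sum over integers as the integral of a step function of mesh `1 / s`. -/
theorem integral_step_eq_sum {s : ℝ} (hs : 0 < s) (t : Finset ℤ) (g : ℤ → ℝ) :
    Integrable (fun x : ℝ => if ⌊x * s⌋ ∈ t then s * g ⌊x * s⌋ else 0) ∧
      ∫ x : ℝ, (if ⌊x * s⌋ ∈ t then s * g ⌊x * s⌋ else 0) = ∑ j ∈ t, g j := by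
  have h : (fun x : ℝ => if ⌊x * s⌋ ∈ t then s * g ⌊x * s⌋ else 0)
      = fun x => ∑ j ∈ t, if ⌊x * s⌋ = j then s * g j else 0 := by
    funext x
    rw [Finset.sum_ite_eq]
  rw [h]
  refine ⟨integrable_finsetSum _ fun j _ => (integral_ite_floor_mul_eq hs j _).1, ?_⟩
  rw [integral_finsetSum _ fun j _ => (integral_ite_floor_mul_eq hs j _).1]
  refine Finset.sum_congr rfl fun j _ => ?_
  rw [(integral_ite_floor_mul_eq hs j _).2]
  field_simp

/-- Riemann sums at mesh `1 / s n → 0` converge, by dominated convergence. -/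
theorem tendsto_sum_of_tendsto_floor {s : ℕ → ℝ} (hs : Tendsto s atTop atTop)
    {g : ℕ → ℤ → ℝ} {φ : ℝ → ℝ} {C a b : ℝ}
    (hg : ∀ᶠ n in atTop, ∀ j, |s n * g n j| ≤ C)
    (hφ : ∀ x, Tendsto (fun n => s n * g n ⌊x * s n⌋) atTop (𝓝 (φ x))) :
    Tendsto (fun n => ∑ j ∈ Finset.Icc (-⌊a * s n⌋) ⌊b * s n⌋, g n j) atTop
      (𝓝 (∫ x in Set.Ioo (-a) b, φ x)) := by
  rw [← integral_indicator measurableSet_Ioo]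
  have hpos := hs.eventually_gt_atTop 0
  refine Tendsto.congr' (f₁ := fun n => ∫ x : ℝ,
    if ⌊x * s n⌋ ∈ Finset.Icc (-⌊a * s n⌋) ⌊b * s n⌋ then s n * g n ⌊x * s n⌋ else 0) ?_ ?_
  · filter_upwards [hpos] with n hn using (integral_step_eq_sum hn _ _).2
  refine tendsto_integral_filter_of_dominated_convergence
    ((Set.Icc (-a) (b + 1)).indicator fun _ => C) ?_ ?_ ?_ ?_
  · filter_upwards [hpos] with n hn using (integral_step_eq_sum hn _ _).1.aestronglyMeasurable
  · filter_upwards [hs.eventually_ge_atTop 1, hg] with n hn hgn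
    refine Eventually.of_forall fun x => ?_
    have hC : 0 ≤ C := (abs_nonneg _).trans (hgn 0)
    split_ifs with hx
    · rw [Finset.mem_Icc] at hx
      have h1 : -(⌊a * s n⌋ : ℝ) ≤ ⌊x * s n⌋ := by exact_mod_cast hx.1
      have h2 : (⌊x * s n⌋ : ℝ) ≤ ⌊b * s n⌋ := by exact_mod_cast hx.2
      have h3 := Int.floor_le (a * s n)
      have h4 := Int.floor_le (x * s n)
      have h5 := Int.lt_floor_add_one (x * s n)
      have h6 := Int.floor_le (b * s n)
      rw [Set.indicator_of_mem]
      · exact hgn _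
      · constructor <;> nlinarith
    · rw [norm_zero]
      exact Set.indicator_nonneg (fun _ _ => hC) _
  · rw [integrable_indicator_iff measurableSet_Icc]
    exact integrableOn_const (by simp)
  · have hne : ∀ᵐ x : ℝ, x ≠ -a ∧ x ≠ b :=
      (Measure.ae_ne volume _).and (Measure.ae_ne volume _)
    filter_upwards [hne] with x hx
    rcases lt_or_gt_of_ne hx.1 with hxa | hxa
    · rw [Set.indicator_of_notMem (fun h => absurd h.1 (by linarith))]
      refine tendsto_const_nhds.congr' ?_
      filter_upwards [hpos] with n hn
      rw [if_neg]
      intro h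
      have h1 : -(⌊a * s n⌋ : ℝ) ≤ ⌊x * s n⌋ := by exact_mod_cast (Finset.mem_Icc.1 h).1
      have h3 := Int.floor_le (a * s n)
      have h4 := Int.floor_le (x * s n)
      nlinarith
    rcases lt_or_gt_of_ne hx.2 with hxb | hxb
    · rw [Set.indicator_of_mem (Set.mem_Ioo.2 ⟨hxa, hxb⟩)]
      refine (hφ x).congr' ?_
      filter_upwards [hpos, (hs.const_mul_atTop (by linarith : 0 < x + a)).eventually_ge_atTop 1]
        with n hn h1
      rw [if_pos]
      refine Finset.mem_Icc.2 ⟨Int.le_floor.2 ?_, Int.floor_le_floor (by gcongr)⟩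
      push_cast
      linarith [Int.lt_floor_add_one (a * s n)]
    · rw [Set.indicator_of_notMem (fun h => absurd h.2 (by linarith))]
      refine tendsto_const_nhds.congr' ?_
      filter_upwards [(hs.const_mul_atTop (by linarith : 0 < x - b)).eventually_ge_atTop 1]
        with n h1
      rw [if_neg]
      intro h
      have h2 : (⌊x * s n⌋ : ℝ) ≤ ⌊b * s n⌋ := by exact_mod_cast (Finset.mem_Icc.1 h).2
      have h5 := Int.lt_floor_add_one (x * s n)
      have h6 := Int.floor_le (b * s n)
      linarith

theorem Phi_sub_Phi {c d : ℝ} (h : c ≤ d) :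
    Phi d - Phi c = ∫ x in Set.Ioo c d, (√(2 * Real.pi))⁻¹ * Real.exp (-x ^ 2 / 2) := by
  have hint : Integrable fun x : ℝ => Real.exp (-x ^ 2 / 2) := by
    have := integrable_exp_neg_mul_sq (by norm_num : (0 : ℝ) < 1 / 2)
    refine this.congr (Eventually.of_forall fun x => ?_)
    simp only
    congr 1
    ring
  unfold Phi
  rw [← mul_sub, intervalIntegral.integral_Iic_sub_Iic hint.integrableOn hint.integrableOn,
    intervalIntegral.integral_of_le h, integral_Ioc_eq_integral_Ioo, integral_const_mul]

open Filter in
/-- de Moivre--Laplace style lemma for the Vandermonde identity -/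
theorem stmt_11 (k : ℕ → ℕ)
    (hko : Tendsto (fun n : ℕ => (k n : ℝ) / (n : ℝ)) atTop (nhds 0))
    (hki : Tendsto k atTop atTop) (a b : ℝ) (ha : 0 ≤ a) (hb : 0 ≤ b) :
    Tendsto
      (fun n : ℕ =>
        (∑ j ∈ Finset.Icc (-(⌊a * Real.sqrt ((k n : ℝ) / 2)⌋)) ⌊b * Real.sqrt ((k n : ℝ) / 2)⌋,
            ((chooseZ (2 * k n) ((k n : ℤ) + j) : ℝ) *
              (chooseZ (2 * (n - k n)) ((n : ℤ) - (k n : ℤ) - j) : ℝ))) /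
          (Nat.choose (2 * n) n : ℝ))
      atTop (nhds (Phi b - Phi (-a))) := by
  have hk' : Tendsto (fun n => (k n : ℝ)) atTop atTop := tendsto_natCast_atTop_atTop.comp hki
  have hhalf : ∀ᶠ n in atTop, 2 * k n < n := by
    filter_upwards [hko.eventually_lt_const (by norm_num : (0 : ℝ) < 1 / 2),
      eventually_gt_atTop 0] with n h1 h0
    have h0' : (0 : ℝ) < n := by exact_mod_cast h0
    rw [div_lt_div_iff₀ h0' two_pos] at h1
    have : (2 : ℝ) * k n < n := by linarith
    exact_mod_cast this
  have hlt : ∀ᶠ n in atTop, k n < n := hhalf.mono fun n hn => by omega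
  have hm : Tendsto (fun n => n - k n) atTop atTop :=
    tendsto_atTop_mono' _ (hhalf.mono fun n hn => (by omega : k n ≤ n - k n)) hki
  have hs : Tendsto (fun n => √((k n : ℝ) / 2)) atTop atTop :=
    Real.tendsto_sqrt_atTop.comp (hk'.atTop_div_const two_pos)
  have hcentral := tendsto_sqrt_mul_centralBinom hko hki hlt hm
  rw [Phi_sub_Phi (by linarith)]
  refine (tendsto_sum_of_tendsto_floor (a := a) (b := b) (C := (√(2 * Real.pi))⁻¹ + 1) hs
    (g := fun n j => ((k n).centralBinom : ℝ) * (n - k n).centralBinom / n.centralBinom *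
      (centralRatio (k n) j.natAbs * centralRatio (n - k n) j.natAbs)) ?_ ?_).congr' ?_
  · filter_upwards [hcentral.eventually_le_const (lt_add_one _)] with n hn j
    have h0 := centralRatio_nonneg (k n) j.natAbs
    have h0' := centralRatio_nonneg (n - k n) j.natAbs
    rw [← mul_assoc, abs_of_nonneg (by positivity)]
    refine (mul_le_of_le_one_right (by positivity) ?_).trans hn
    exact mul_le_one₀ (centralRatio_le_one _ _) h0' (centralRatio_le_one _ _)
  · intro x
    have hj : Tendsto (fun n => ((⌊x * √((k n : ℝ) / 2)⌋.natAbs : ℕ) : ℝ) ^ 2 / k n) atTop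
        (𝓝 (x ^ 2 / 2)) := by
      refine (((tendsto_floor_mul_div hs x).pow 2).div_const 2).congr fun n => ?_
      rw [div_pow, Real.sq_sqrt (by positivity), Nat.cast_natAbs, Int.cast_abs, sq_abs, div_div]
      congr 1
      ring
    have hj' : Tendsto (fun n => ((⌊x * √((k n : ℝ) / 2)⌋.natAbs : ℕ) : ℝ) ^ 2 /
        (n - k n : ℕ)) atTop (𝓝 0) := by
      have h1 := hj.mul (hko.div (tendsto_const_nhds.sub hko) (by norm_num : (1 : ℝ) - 0 ≠ 0))
      rw [zero_div, mul_zero] at h1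
      refine h1.congr' ?_
      filter_upwards [hlt, hki.eventually_gt_atTop 0] with n hn hk
      have hk0 : (0 : ℝ) < k n := by exact_mod_cast hk
      have hn0 : (0 : ℝ) < n := by exact_mod_cast (by omega : 0 < n)
      simp only [Pi.div_apply]
      rw [one_sub_div hn0.ne', div_div_div_cancel_right₀ hn0.ne', Nat.cast_sub hn.le,
        div_mul_div_cancel₀ hk0.ne']
    have h := hcentral.mul ((tendsto_centralRatio hki hj).mul (tendsto_centralRatio hm hj'))
    rw [neg_zero, Real.exp_zero, mul_one, ← neg_div] at h
    exact h.congr fun n => by ring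
  · filter_upwards [hlt] with n hn
    rw [Finset.sum_div]
    refine Finset.sum_congr rfl fun j _ => ?_
    rw [show (n : ℤ) - k n - j = ((n - k n : ℕ) : ℤ) + -j by omega, chooseZ_two_mul_add,
      chooseZ_two_mul_add, Int.natAbs_neg, choose_two_mul_eq, choose_two_mul_eq,
      ← Nat.centralBinom_eq_two_mul_choose]
    ring
end

section
/- Let c > 0 and let k : ℕ → ℕ satisfy k(m) = o(m) and lim_{m→∞} k(m) = ∞. Then lim_{m→∞} |F_{k(m)}(2m, m, ⌊c√(k(m))⌋)| / C(2m, m) = (1/√(2π)) ∫_{c/√2}^∞ e^{−x²/2} dx = 1 − Φ(c/√2). -/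
open MeasureTheory ProbabilityTheory Filter Topology

theorem inv_sqrt_mul_setIntegral_eq_gaussianReal (s : Set ℝ) :
    (Real.sqrt (2 * Real.pi))⁻¹ * ∫ x in s, Real.exp (-x ^ 2 / 2) =
      (gaussianReal 0 1).real s := by
  rw [measureReal_def, gaussianReal_apply_eq_integral _ one_ne_zero,
    ENNReal.toReal_ofReal (integral_nonneg fun x => gaussianPDFReal_nonneg _ _ _),
    ← integral_const_mul]
  simp [gaussianPDFReal]

theorem four_pow_mul_centralBinom_mul_sqrt_le {l m : ℕ} (h : l ≤ m) :
    (4 : ℝ) ^ (m - l) * l.centralBinom * √l ≤ m.centralBinom * √m := by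
  induction m, h using Nat.le_induction with
  | base => simp
  | succ m h ih =>
    have hrec : ((m : ℝ) + 1) * (m + 1).centralBinom = 2 * (2 * m + 1) * m.centralBinom := by
      exact_mod_cast m.succ_mul_centralBinom_succ
    have hstep : 4 * ((m : ℝ) + 1) * √m ≤ 2 * (2 * m + 1) * √(m + 1 : ℝ) := by
      apply le_of_sq_le_sq _ (by positivity)
      rw [mul_pow, mul_pow _ (√_), Real.sq_sqrt m.cast_nonneg, Real.sq_sqrt (by positivity)]
      nlinarith
    rw [Nat.succ_sub h, pow_succ]
    push_cast
    have hc : (0 : ℝ) ≤ m.centralBinom := by positivity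
    have hm : (0 : ℝ) < m + 1 := by positivity
    refine le_of_mul_le_mul_left ?_ hm
    calc ((m : ℝ) + 1) * (4 ^ (m - l) * 4 * l.centralBinom * √l)
        = 4 * (m + 1) * (4 ^ (m - l) * l.centralBinom * √l) := by ring
      _ ≤ 4 * (m + 1) * (m.centralBinom * √m) := by gcongr
      _ = 4 * (m + 1) * √m * m.centralBinom := by ring
      _ ≤ 2 * (2 * m + 1) * √(m + 1 : ℝ) * m.centralBinom := by gcongr
      _ = (m + 1) * (m + 1).centralBinom * √(m + 1 : ℝ) := by rw [hrec]; ring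
      _ = _ := by ring

theorem choose_le_two_pow_mul_centralBinom (n j : ℕ) :
    n.choose j ≤ 2 ^ (n % 2) * (n / 2).centralBinom := by
  obtain ⟨l, rfl | rfl⟩ := n.even_or_odd'
  · simpa using Nat.choose_le_centralBinom j l
  · rw [show (2 * l + 1) % 2 = 1 by omega, show (2 * l + 1) / 2 = l by omega]
    cases j with
    | zero =>
      have := l.centralBinom_pos
      rw [Nat.choose_zero_right]
      omega
    | succ j =>
      rw [Nat.choose_succ_succ]
      have h1 := Nat.choose_le_centralBinom j l
      have h2 := Nat.choose_le_centralBinom (j + 1) l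
      simp only [Nat.succ_eq_add_one]
      omega

theorem two_pow_mul_choose_le {m N : ℕ} (hN : N ≤ 2 * m) (hl : 0 < (2 * m - N) / 2) (j : ℕ) :
    (2 : ℝ) ^ N * (2 * m - N).choose j ≤
      √(m / ((2 * m - N) / 2 : ℕ)) * (2 * m).choose m := by
  set l := (2 * m - N) / 2 with hldef
  have hlm : l ≤ m := by omega
  have h1 : ((2 * m - N).choose j : ℝ) ≤ 2 ^ ((2 * m - N) % 2) * l.centralBinom := by
    exact_mod_cast choose_le_two_pow_mul_centralBinom (2 * m - N) j
  have h2 : (2 : ℝ) ^ N * 2 ^ ((2 * m - N) % 2) = 4 ^ (m - l) := by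
    rw [← pow_add, show (4 : ℝ) = 2 ^ 2 by norm_num, ← pow_mul]
    congr 1
    omega
  have hs : 0 < √(l : ℝ) := by positivity
  have h3 := four_pow_mul_centralBinom_mul_sqrt_le hlm
  rw [Real.sqrt_div (by positivity), ← Nat.centralBinom_eq_two_mul_choose, div_mul_eq_mul_div,
    le_div_iff₀ hs]
  calc (2 : ℝ) ^ N * (2 * m - N).choose j * √l
      ≤ 2 ^ N * (2 ^ ((2 * m - N) % 2) * l.centralBinom) * √l := by gcongr
    _ = 4 ^ (m - l) * l.centralBinom * √l := by rw [← h2]; ring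
    _ ≤ _ := by linarith

theorem card_filter_inter_le {n k N B : ℕ}
    (hB : ∀ j, (n - N).choose j ≤ B) (P : Finset ℕ → Prop) [DecidablePred P] :
    (((Finset.Icc 1 n).powersetCard k).filter fun F => P (F ∩ Finset.Icc 1 N)).card ≤
      ((Finset.Icc 1 N).powerset.filter P).card * B := by
  rw [mul_comm _ B]
  refine Finset.card_le_mul_card_image_of_maps_to (f := fun F => F ∩ Finset.Icc 1 N) ?_ _ ?_
  · intro F hF
    simp only [Finset.mem_filter, Finset.mem_powersetCard, Finset.mem_powerset] at hF ⊢
    exact ⟨Finset.inter_subset_right, hF.2⟩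
  · intro A hA
    refine le_trans ?_ (hB (k - A.card))
    have hc : (Finset.Icc (N + 1) n).card = n - N := by simp
    rw [← hc, ← Finset.card_powersetCard]
    refine Finset.card_le_card_of_injOn (fun F => F \ Finset.Icc 1 N) ?_ ?_
    · intro F hF
      simp only [Finset.coe_filter, Finset.mem_filter, Finset.mem_powersetCard, Set.mem_ofPred_eq,
        Finset.mem_coe] at hF ⊢
      obtain ⟨⟨⟨hF1, hF2⟩, -⟩, rfl⟩ := hF
      refine ⟨fun x hx => ?_, ?_⟩
      · have := @hF1 x
        simp only [Finset.mem_sdiff, Finset.mem_Icc] at hx this ⊢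
        have := this hx.1
        omega
      · have := Finset.card_inter_add_card_sdiff F (Finset.Icc 1 N)
        omega
    · intro F hF G hG hFG
      simp only [Finset.coe_filter, Finset.mem_filter, Set.mem_ofPred_eq] at hF hG
      rw [← Finset.sdiff_union_inter F (Finset.Icc 1 N),
        ← Finset.sdiff_union_inter G (Finset.Icc 1 N),
        hF.2, hG.2]
      exact congrArg (· ∪ A) hFG

/-- The point `1 / 2` of the unit interval. -/
noncomputable def unitHalf : unitInterval := ⟨1 / 2, by norm_num, by norm_num⟩

/-- The law of `(2 X - n) / √n`, where `X` is binomial with parameters `n` and `1 / 2`. -/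
noncomputable def stdBinomial (n : ℕ) : ProbabilityMeasure ℝ :=
  ⟨(binomial n unitHalf).map fun j : ℕ => (√n)⁻¹ * (2 * j - n),
    Measure.isProbabilityMeasure_map (by fun_prop)⟩

theorem charFun_stdBinomial (n : ℕ) (t : ℝ) :
    charFun (stdBinomial n : Measure ℝ) t =
      charFun ((bernoulliMeasure (1 : ℝ) (-1) unitHalf).map id) ((√n)⁻¹ * t) ^ n := by
  rw [charFun_apply_real, charFun_apply_real, Measure.map_id, integral_bernoulliMeasure, add_pow]
  change ∫ x, _ ∂(Measure.map _ _) = _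
  rw [integral_map (by fun_prop) (by fun_prop), integral_binomial, Nat.range_succ_eq_Iic]
  refine Finset.sum_congr rfl fun j hj => ?_
  have hj : j ≤ n := by simpa using hj
  simp only [Complex.real_smul, mul_pow, ← Complex.exp_nat_mul]
  push_cast [Nat.cast_sub hj]
  have : Complex.exp (t * (((√n : ℝ) : ℂ)⁻¹ * (2 * j - n)) * Complex.I) =
      Complex.exp (j * (((√n : ℝ) : ℂ)⁻¹ * t * 1 * Complex.I)) *
        Complex.exp ((n - j) * (((√n : ℝ) : ℂ)⁻¹ * t * -1 * Complex.I)) := by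
    rw [← Complex.exp_add]
    congr 1
    ring
  rw [this]
  ring

theorem tendsto_stdBinomial :
    Tendsto stdBinomial atTop (𝓝 ⟨gaussianReal 0 1, inferInstance⟩) := by
  refine ProbabilityMeasure.tendsto_iff_tendsto_charFun.2 fun t => ?_
  simp_rw [charFun_stdBinomial]
  have h0 : (bernoulliMeasure (1 : ℝ) (-1) unitHalf)[(id : ℝ → ℝ)] = 0 := by
    rw [integral_bernoulliMeasure]
    norm_num [unitHalf]
  have h1 : (bernoulliMeasure (1 : ℝ) (-1) unitHalf)[(id : ℝ → ℝ) ^ 2] = 1 := by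
    rw [integral_bernoulliMeasure]
    norm_num [unitHalf]
  simpa [charFun_gaussianReal, neg_div] using
    tendsto_charFun_inv_sqrt_mul_pow aemeasurable_id h0 h1 t

theorem tendsto_stdBinomial_Ici (x : ℝ) :
    Tendsto (fun n => (stdBinomial n : Measure ℝ).real (Set.Ici x)) atTop
      (𝓝 ((gaussianReal 0 1).real (Set.Ici x))) := by
  have : NullSingletonClass (gaussianReal 0 1) := nullSingletonClass_gaussianReal one_ne_zero
  have h := ProbabilityMeasure.tendsto_measure_of_null_frontier_of_tendsto' tendsto_stdBinomial
    (E := Set.Ici x)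
    (by rw [frontier_Ici]; exact this.measure_singleton x)
  exact (ENNReal.tendsto_toReal (measure_ne_top _ _)).comp h

theorem continuous_gaussianReal_Ici :
    Continuous fun x => (gaussianReal 0 1).real (Set.Ici x) := by
  have hint := integrable_gaussianPDFReal 0 1
  have h (x : ℝ) : (gaussianReal 0 1).real (Set.Ici x) =
      (gaussianReal 0 1).real (Set.Ici 0) - ∫ y in (0 : ℝ)..x, gaussianPDFReal 0 1 y := by
    have hI (z : ℝ) : (gaussianReal 0 1).real (Set.Ici z) =
        ∫ y in Set.Ioi z, gaussianPDFReal 0 1 y := by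
      rw [measureReal_def, gaussianReal_apply_eq_integral _ one_ne_zero,
        ENNReal.toReal_ofReal (integral_nonneg fun x => gaussianPDFReal_nonneg _ _ _),
        integral_Ici_eq_integral_Ioi]
    rw [hI, hI, ← intervalIntegral.integral_Ioi_sub_Ioi' hint.integrableOn hint.integrableOn]
    ring
  refine Continuous.congr (continuous_const.sub ?_) fun x => (h x).symm
  exact intervalIntegral.continuous_primitive (fun _ _ => hint.intervalIntegrable) 0

/-- Weak convergence to the Gaussian, evaluated along a convergent sequence of thresholds. -/
theorem tendsto_stdBinomial_Ici_of_tendsto {N : ℕ → ℕ} {y : ℕ → ℝ} {x : ℝ}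
    (hN : Tendsto N atTop atTop) (hy : Tendsto y atTop (𝓝 x)) :
    Tendsto (fun m => (stdBinomial (N m) : Measure ℝ).real (Set.Ici (y m))) atTop
      (𝓝 ((gaussianReal 0 1).real (Set.Ici x))) := by
  refine tendsto_order.2 ⟨fun b hb => ?_, fun b hb => ?_⟩
  · obtain ⟨z, hz, hxz⟩ := ((continuous_gaussianReal_Ici.continuousAt.eventually_const_lt
      hb).filter_mono nhdsWithin_le_nhds |>.and (self_mem_nhdsWithin : Set.Ioi x ∈ 𝓝[>] x)).exists
    filter_upwards [((tendsto_stdBinomial_Ici z).comp hN).eventually_const_lt hz,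
      hy.eventually_lt_const hxz] with m h1 h2
    exact h1.trans_le (measureReal_mono (Set.Ici_subset_Ici.2 h2.le))
  · obtain ⟨z, hz, hxz⟩ := ((continuous_gaussianReal_Ici.continuousAt.eventually_lt_const
      hb).filter_mono nhdsWithin_le_nhds |>.and (self_mem_nhdsWithin : Set.Iio x ∈ 𝓝[<] x)).exists
    filter_upwards [((tendsto_stdBinomial_Ici z).comp hN).eventually_lt_const hz,
      hy.eventually_const_lt hxz] with m h1 h2
    exact (measureReal_mono (Set.Ici_subset_Ici.2 h2.le)).trans_lt h1

theorem stdBinomial_Ici {n : ℕ} (hn : 0 < n) (a : ℕ) :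
    (stdBinomial n : Measure ℝ).real (Set.Ici ((√n)⁻¹ * (2 * a - n))) =
      (((Finset.Icc 1 n).powerset.filter fun A => a ≤ A.card).card : ℝ) / 2 ^ n := by
  have hs : 0 < (√(n : ℝ))⁻¹ := by positivity
  change (Measure.map _ _).real _ = _
  rw [map_measureReal_apply (by fun_prop) measurableSet_Ici]
  have : (fun j : ℕ => (√n)⁻¹ * (2 * (j : ℝ) - n)) ⁻¹' Set.Ici ((√n)⁻¹ * (2 * a - n)) =
      Set.Ici a := by
    ext j
    simp [hs]
  rw [this, ← integral_indicator_one measurableSet_Ici, integral_binomial,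
    Finset.card_filter, Finset.sum_powerset_apply_card (fun j => if a ≤ j then 1 else 0),
    Nat.card_Icc, Nat.add_sub_cancel, Nat.range_succ_eq_Iic, Nat.cast_sum, Finset.sum_div]
  refine Finset.sum_congr rfl fun j hj => ?_
  have hj : j ≤ n := by simpa using hj
  have h2 : ((unitHalf : ℝ)) ^ j * (1 - (unitHalf : ℝ)) ^ (n - j) = 1 / 2 ^ n := by
    have : (1 : ℝ) - (unitHalf : ℝ) = unitHalf := by norm_num [unitHalf]
    rw [this, ← pow_add, Nat.add_sub_cancel' hj]
    simp [unitHalf]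
  rw [mul_assoc, h2]
  by_cases h : a ≤ j <;> simp [h, div_eq_mul_inv]

theorem abs_card_Fam_div_choose_sub_le {m t i : ℕ} (hN : t + 2 * i ≤ 2 * m)
    (hl : 0 < (2 * m - (t + 2 * i)) / 2) :
    |((Fam (2 * m) m t i).card : ℝ) / (2 * m).choose m -
      (((Finset.Icc 1 (t + 2 * i)).powerset.filter fun A => t + i ≤ A.card).card : ℝ) /
        2 ^ (t + 2 * i)| ≤ √(m / ((2 * m - (t + 2 * i)) / 2 : ℕ)) - 1 := by
  set N := t + 2 * i with hNdef
  set R := √(m / ((2 * m - N) / 2 : ℕ))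
  have hC : (0 : ℝ) < (2 * m).choose m := by
    exact_mod_cast Nat.choose_pos (by omega)
  have key (P : Finset ℕ → Prop) [DecidablePred P] :
      ((((Finset.Icc 1 (2 * m)).powersetCard m).filter
        fun F => P (F ∩ Finset.Icc 1 N)).card : ℝ) / (2 * m).choose m ≤
      (((Finset.Icc 1 N).powerset.filter P).card : ℝ) / 2 ^ N * R := by
    have h1 : ((((Finset.Icc 1 (2 * m)).powersetCard m).filter
        fun F => P (F ∩ Finset.Icc 1 N)).card : ℝ) ≤
        ((Finset.Icc 1 N).powerset.filter P).card *
          ((2 * m - N).choose ((2 * m - N) / 2) : ℕ) := by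
      exact_mod_cast card_filter_inter_le (fun j => Nat.choose_le_middle j _) P
    have h2 := two_pow_mul_choose_le hN hl ((2 * m - N) / 2)
    rw [div_le_iff₀ hC]
    refine h1.trans ?_
    rw [div_mul_eq_mul_div, div_mul_eq_mul_div, le_div_iff₀ (by positivity), mul_assoc, mul_assoc]
    refine mul_le_mul_of_nonneg_left ?_ (Nat.cast_nonneg _)
    rwa [mul_comm]
  have hFam : Fam (2 * m) m t i = ((Finset.Icc 1 (2 * m)).powersetCard m).filter
      fun F => t + i ≤ (F ∩ Finset.Icc 1 N).card := by
    ext F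
    simp [Fam, Finset.mem_powersetCard, and_assoc, hNdef]
  have hle := key fun A => t + i ≤ A.card
  have hge := key fun A => ¬ t + i ≤ A.card
  have hq : ((Fam (2 * m) m t i).card : ℝ) / (2 * m).choose m +
      ((((Finset.Icc 1 (2 * m)).powersetCard m).filter
        fun F => ¬ t + i ≤ (F ∩ Finset.Icc 1 N).card).card : ℝ) / (2 * m).choose m = 1 := by
    rw [hFam, ← add_div, div_eq_one_iff_eq hC.ne', ← Nat.cast_add,
      Finset.card_filter_add_card_filter_not]
    simp
  have hp : (((Finset.Icc 1 N).powerset.filter fun A => t + i ≤ A.card).card : ℝ) / 2 ^ N +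
      (((Finset.Icc 1 N).powerset.filter fun A => ¬ t + i ≤ A.card).card : ℝ) / 2 ^ N = 1 := by
    rw [← add_div, div_eq_one_iff_eq (by positivity), ← Nat.cast_add,
      Finset.card_filter_add_card_filter_not]
    simp
  rw [← hFam] at hle
  have hp0 : (0 : ℝ) ≤
    (((Finset.Icc 1 N).powerset.filter fun A => t + i ≤ A.card).card : ℝ) / 2 ^ N := by positivity
  have hp1 : (0 : ℝ) ≤
    (((Finset.Icc 1 N).powerset.filter fun A => ¬ t + i ≤ A.card).card : ℝ) / 2 ^ N := by
    positivity
  generalize (((Finset.Icc 1 N).powerset.filter fun A => t + i ≤ A.card).card : ℝ) / 2 ^ N = p at *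
  generalize
    (((Finset.Icc 1 N).powerset.filter fun A => ¬ t + i ≤ A.card).card : ℝ) / 2 ^ N = p' at *
  generalize ((Fam (2 * m) m t i).card : ℝ) / (2 * m).choose m = q at *
  have hR : 1 ≤ R := by nlinarith
  rw [abs_le]
  constructor <;> nlinarith

theorem tendsto_nat_floor_mul_sqrt_div_sqrt {c : ℝ} (hc : 0 ≤ c) {k : ℕ → ℕ}
    (hk : Tendsto k atTop atTop) :
    Tendsto (fun m => (⌊c * √(k m : ℝ)⌋₊ : ℝ) / √(k m : ℝ)) atTop (𝓝 c) :=
  (tendsto_nat_floor_mul_div_atTop hc).comp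
    (Real.tendsto_sqrt_atTop.comp (tendsto_natCast_atTop_atTop.comp hk))

theorem tendsto_inv_sqrt_mul_two_mul_sub {c : ℝ} (hc : 0 ≤ c) {k : ℕ → ℕ} (hk : Tendsto k atTop atTop) :
    Tendsto (fun m => (√((⌊c * √(k m : ℝ)⌋₊ + 2 * k m : ℕ) : ℝ))⁻¹ *
      (2 * ((⌊c * √(k m : ℝ)⌋₊ + k m : ℕ) : ℝ) - (⌊c * √(k m : ℝ)⌋₊ + 2 * k m : ℕ)))
      atTop (𝓝 (c / √2)) := by
  have h1 := tendsto_nat_floor_mul_sqrt_div_sqrt hc hk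
  have h2 : Tendsto (fun m => (√(k m : ℝ))⁻¹) atTop (𝓝 0) :=
    tendsto_inv_atTop_zero.comp
      (Real.tendsto_sqrt_atTop.comp (tendsto_natCast_atTop_atTop.comp hk))
  have h3 := h1.div (((h1.mul h2).add_const 2).sqrt) (by simp)
  rw [mul_zero, zero_add] at h3
  refine h3.congr' ?_
  filter_upwards [hk.eventually_gt_atTop 0] with m hm
  have hs : 0 < √(k m : ℝ) := by positivity
  have hsq : √(k m : ℝ) * √(k m : ℝ) = k m := Real.mul_self_sqrt (by positivity)
  simp only [Pi.div_apply]
  generalize ⌊c * √(k m : ℝ)⌋₊ = t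
  have : ((t + 2 * k m : ℕ) : ℝ) = k m * (t / √(k m : ℝ) * (√(k m : ℝ))⁻¹ + 2) := by
    push_cast
    field_simp
    rw [Real.sq_sqrt (by positivity)]
    ring
  rw [show 2 * ((t + k m : ℕ) : ℝ) - (t + 2 * k m : ℕ) = t by push_cast; ring, this,
    Real.sqrt_mul (by positivity), mul_inv]
  field_simp

theorem tendsto_floor_add_div {c : ℝ} (hc : 0 ≤ c) {k : ℕ → ℕ}
    (hko : Tendsto (fun m : ℕ => (k m : ℝ) / (m : ℝ)) atTop (𝓝 0))
    (hk : Tendsto k atTop atTop) :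
    Tendsto (fun m : ℕ => ((⌊c * √(k m : ℝ)⌋₊ + 2 * k m : ℕ) : ℝ) / m) atTop (𝓝 0) := by
  have h := hko.const_mul (c + 2)
  rw [mul_zero] at h
  refine squeeze_zero' (Eventually.of_forall fun m => by positivity) ?_ h
  filter_upwards [hk.eventually_ge_atTop 1] with m hm
  rw [← mul_div_assoc]
  gcongr
  push_cast
  have h1 : (⌊c * √(k m : ℝ)⌋₊ : ℝ) ≤ c * √(k m : ℝ) := Nat.floor_le (by positivity)
  have h2 : √(k m : ℝ) ≤ k m := Real.sqrt_le_iff.2 ⟨by positivity, by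
    have : (1 : ℝ) ≤ k m := by exact_mod_cast hm
    nlinarith⟩
  nlinarith

theorem tendsto_sqrt_div_half_sub {N : ℕ → ℕ}
    (hN : Tendsto (fun m : ℕ => (N m : ℝ) / m) atTop (𝓝 0)) :
    Tendsto (fun m : ℕ => √((m : ℝ) / ((2 * m - N m) / 2 : ℕ))) atTop (𝓝 1) := by
  have hl : Tendsto (fun m : ℕ => (((2 * m - N m) / 2 : ℕ) : ℝ) / m) atTop (𝓝 1) := by
    have hlow : Tendsto (fun m : ℕ => 1 - (N m : ℝ) / m - (m : ℝ)⁻¹) atTop (𝓝 1) := by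
      simpa using (hN.const_sub 1).sub (tendsto_inv_atTop_zero.comp tendsto_natCast_atTop_atTop)
    refine tendsto_of_tendsto_of_tendsto_of_le_of_le' hlow tendsto_const_nhds ?_ ?_
    · filter_upwards [eventually_gt_atTop 0] with m hm
      have hm' : (0 : ℝ) < m := by exact_mod_cast hm
      have : (m : ℝ) ≤ ((2 * m - N m) / 2 : ℕ) + N m + 1 := by
        exact_mod_cast (by omega : m ≤ (2 * m - N m) / 2 + N m + 1)
      rw [le_div_iff₀ hm']
      field_simp
      linarith
    · filter_upwards with m
      refine div_le_one_of_le₀ ?_ (by positivity)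
      exact_mod_cast (by omega : (2 * m - N m) / 2 ≤ m)
  simpa using (hl.inv₀ one_ne_zero).sqrt

open Filter in
theorem stmt_12 (c : ℝ) (hc : 0 < c) (k : ℕ → ℕ)
    (hko : Tendsto (fun m : ℕ => (k m : ℝ) / (m : ℝ)) atTop (nhds 0))
    (hki : Tendsto k atTop atTop) :
    Tendsto
        (fun m : ℕ =>
          ((Fam (2 * m) m ⌊c * Real.sqrt (k m : ℝ)⌋₊ (k m)).card : ℝ) /
            (Nat.choose (2 * m) m : ℝ))
        atTop
        (nhds ((Real.sqrt (2 * Real.pi))⁻¹ *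
          ∫ x in Set.Ioi (c / Real.sqrt 2), Real.exp (-x ^ 2 / 2))) ∧
      (Real.sqrt (2 * Real.pi))⁻¹ * (∫ x in Set.Ioi (c / Real.sqrt 2), Real.exp (-x ^ 2 / 2)) =
        1 - Phi (c / Real.sqrt 2) := by
  constructor
  · rw [← integral_Ici_eq_integral_Ioi, inv_sqrt_mul_setIntegral_eq_gaussianReal]
    have hN0 := tendsto_floor_add_div hc.le hko hki
    have hNtop : Tendsto (fun m => ⌊c * √(k m : ℝ)⌋₊ + 2 * k m) atTop atTop :=
      tendsto_atTop_mono (fun m => by omega) hki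
    have hlim := tendsto_stdBinomial_Ici_of_tendsto hNtop
      (tendsto_inv_sqrt_mul_two_mul_sub hc.le hki)
    have herr := (tendsto_sqrt_div_half_sub hN0).sub_const 1
    rw [sub_self] at herr
    refine hlim.congr_dist (squeeze_zero' (Eventually.of_forall fun _ => dist_nonneg) ?_ herr)
    filter_upwards [hN0.eventually_lt_const (zero_lt_one), hNtop.eventually_gt_atTop 0,
      eventually_ge_atTop 2] with m hm hpos hm2
    have hNm : ⌊c * √(k m : ℝ)⌋₊ + 2 * k m < m := by
      rw [div_lt_one (by positivity)] at hm
      exact_mod_cast hm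
    rw [stdBinomial_Ici hpos, dist_comm, Real.dist_eq]
    have hN : ⌊c * √(k m : ℝ)⌋₊ + 2 * k m ≤ 2 * m := by omega
    exact abs_card_Fam_div_choose_sub_le hN (by omega)
  · rw [Phi, inv_sqrt_mul_setIntegral_eq_gaussianReal, inv_sqrt_mul_setIntegral_eq_gaussianReal,
      ← Set.compl_Iic, probReal_compl_eq_one_sub measurableSet_Iic]
end

section
/- Let t, l : ℕ → ℕ satisfy t(m) = o(m), l(m) = o(m), and lim_{m→∞} (t(m) + l(m)) = ∞. If lim_{m→∞} t(m)/√(l(m)) = ∞, then lim_{m→∞} |F_{l(m)}(2m, m, t(m))| / C(2m, m) = 0. -/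
open Finset in
/-- The sum of the signs of membership in `F` over `S` is `2 |F ∩ S| - |S|`. -/
lemma sum_sign_eq {α : Type*} [DecidableEq α] (F S : Finset α) :
    ∑ i ∈ S, (if i ∈ F then (1 : ℤ) else -1) = 2 * (#(F ∩ S) : ℤ) - #S := by
  have h : ∀ i, (if i ∈ F then (1 : ℤ) else -1) = 2 * (if i ∈ F then 1 else 0) - 1 := by
    intro i
    split_ifs <;> norm_num
  simp only [h, sum_sub_distrib, ← mul_sum, sum_boole, filter_mem_eq_inter, inter_comm F S]
  simp

open Finset in
/-- The correlation of the membership signs at `i` and `j`, over all `m`-subsets of `A`, is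
unchanged when `j` is replaced by another element of `A` different from `i`. -/
lemma sum_sign_mul_sign_swap {α : Type*} [DecidableEq α] (A : Finset α) (m : ℕ) {i j k : α}
    (hj : j ∈ A) (hk : k ∈ A) (hij : i ≠ j) (hik : i ≠ k) :
    ∑ F ∈ A.powersetCard m, (if i ∈ F then (1 : ℤ) else -1) * (if j ∈ F then 1 else -1) =
      ∑ F ∈ A.powersetCard m, (if i ∈ F then (1 : ℤ) else -1) * (if k ∈ F then 1 else -1) := by
  have hmem : ∀ F ∈ A.powersetCard m,
      F.map (Equiv.swap j k).toEmbedding ∈ A.powersetCard m := by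
    intro F hF
    rw [mem_powersetCard] at hF ⊢
    refine ⟨fun a ha => ?_, by rw [card_map, hF.2]⟩
    rw [mem_map_equiv, Equiv.symm_swap] at ha
    by_cases haj : a = j
    · rwa [haj]
    by_cases hak : a = k
    · rwa [hak]
    rw [Equiv.swap_apply_of_ne_of_ne haj hak] at ha
    exact hF.1 ha
  have hinv : ∀ F : Finset α,
      (F.map (Equiv.swap j k).toEmbedding).map (Equiv.swap j k).toEmbedding = F := by
    intro F
    ext a
    simp only [mem_map_equiv, Equiv.symm_swap, Equiv.swap_apply_self]
  refine sum_nbij' (fun F => F.map (Equiv.swap j k).toEmbedding)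
    (fun F => F.map (Equiv.swap j k).toEmbedding) hmem hmem (fun F _ => hinv F)
    (fun F _ => hinv F) fun F _ => ?_
  simp only [mem_map_equiv, Equiv.symm_swap, Equiv.swap_apply_right,
    Equiv.swap_apply_of_ne_of_ne hij hik]

open Finset in
/-- Over all `m`-subsets of a `2m`-set, membership signs at distinct points are negatively
correlated. -/
lemma sum_sign_mul_sign_nonpos {α : Type*} [DecidableEq α] {A : Finset α} {m : ℕ}
    (hA : #A = 2 * m) {i j : α} (hi : i ∈ A) (hj : j ∈ A) (hij : i ≠ j) :
    ∑ F ∈ A.powersetCard m, (if i ∈ F then (1 : ℤ) else -1) * (if j ∈ F then 1 else -1) ≤ 0 := by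
  set c := ∑ F ∈ A.powersetCard m, (if i ∈ F then (1 : ℤ) else -1) * (if j ∈ F then 1 else -1)
  have hzero : ∑ k ∈ A, ∑ F ∈ A.powersetCard m,
      (if i ∈ F then (1 : ℤ) else -1) * (if k ∈ F then 1 else -1) = 0 := by
    rw [sum_comm]
    refine sum_eq_zero fun F hF => ?_
    rw [mem_powersetCard] at hF
    rw [← mul_sum, sum_sign_eq, inter_eq_left.2 hF.1, hF.2, hA]
    push_cast
    ring
  rw [← add_sum_erase A _ hi] at hzero
  have hoff : ∑ k ∈ A.erase i, ∑ F ∈ A.powersetCard m,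
      (if i ∈ F then (1 : ℤ) else -1) * (if k ∈ F then 1 else -1) = #(A.erase i) * c := by
    rw [← nsmul_eq_mul]
    refine sum_eq_card_nsmul fun k hk => ?_
    rw [mem_erase] at hk
    exact sum_sign_mul_sign_swap A m hk.2 hj hk.1.symm hij
  have hdiag : 0 ≤ ∑ F ∈ A.powersetCard m,
      (if i ∈ F then (1 : ℤ) else -1) * (if i ∈ F then 1 else -1) :=
    sum_nonneg fun F _ => mul_self_nonneg _
  have hpos : (0 : ℤ) < #(A.erase i) := by
    exact_mod_cast card_pos.2 ⟨j, mem_erase.2 ⟨hij.symm, hj⟩⟩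
  rw [hoff] at hzero
  by_contra! hlt
  nlinarith [mul_pos hpos hlt]

open Finset in
/-- Second moment bound: for `S` inside a `2m`-set `A` and a uniform `m`-subset `F` of `A`,
the mean of `(2 |F ∩ S| - |S|)²` is at most `|S|`. -/
lemma sum_sq_two_mul_card_inter_sub_le {α : Type*} [DecidableEq α] {A S : Finset α} {m : ℕ}
    (hA : #A = 2 * m) (hS : S ⊆ A) :
    ∑ F ∈ A.powersetCard m, (2 * (#(F ∩ S) : ℤ) - #S) ^ 2 ≤
      (#S : ℤ) * ((2 * m).choose m : ℤ) := by
  simp only [← sum_sign_eq, sq, sum_mul_sum]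
  rw [sum_comm, ← nsmul_eq_mul]
  refine sum_le_card_nsmul _ _ _ fun i hi => ?_
  rw [sum_comm, ← add_sum_erase S _ hi]
  have hdiag : ∑ F ∈ A.powersetCard m,
      (if i ∈ F then (1 : ℤ) else -1) * (if i ∈ F then 1 else -1) = (2 * m).choose m := by
    rw [← hA, ← card_powersetCard, card_eq_sum_ones]
    push_cast
    refine sum_congr rfl fun F _ => ?_
    split_ifs <;> norm_num
  have hoff : ∑ j ∈ S.erase i, ∑ F ∈ A.powersetCard m,
      (if i ∈ F then (1 : ℤ) else -1) * (if j ∈ F then 1 else -1) ≤ 0 := by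
    refine sum_nonpos fun j hj => ?_
    rw [mem_erase] at hj
    exact sum_sign_mul_sign_nonpos hA (hS hi) (hS hj.2) hj.1.symm
  linarith

/-- Chebyshev bound for the size of `Fam (2 * m) m t l`. -/
lemma card_Fam_mul_sq_le {m t l : ℕ} (h : t + 2 * l ≤ 2 * m) :
    (Fam (2 * m) m t l).card * t ^ 2 ≤ (t + 2 * l) * (2 * m).choose m := by
  have hS : Finset.Icc 1 (t + 2 * l) ⊆ Finset.Icc 1 (2 * m) := Finset.Icc_subset_Icc_right h
  have key := sum_sq_two_mul_card_inter_sub_le (m := m) (by simp) hS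
  have hsub : Fam (2 * m) m t l ⊆ (Finset.Icc 1 (2 * m)).powersetCard m := by
    intro F hF
    rw [Fam, Finset.mem_filter, Finset.mem_powerset] at hF
    exact Finset.mem_powersetCard.2 ⟨hF.1, hF.2.1⟩
  have hsum := Finset.sum_le_sum_of_subset_of_nonneg hsub
    (f := fun F => (2 * ((F ∩ Finset.Icc 1 (t + 2 * l)).card : ℤ)
      - (Finset.Icc 1 (t + 2 * l)).card) ^ 2) (fun _ _ _ => sq_nonneg _)
  have hlow : (Fam (2 * m) m t l).card • ((t : ℤ) ^ 2) ≤ ∑ F ∈ Fam (2 * m) m t l,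
      (2 * ((F ∩ Finset.Icc 1 (t + 2 * l)).card : ℤ) - (Finset.Icc 1 (t + 2 * l)).card) ^ 2 := by
    refine Finset.card_nsmul_le_sum _ _ _ fun F hF => ?_
    rw [Fam, Finset.mem_filter] at hF
    refine pow_le_pow_left₀ (by positivity) ?_ 2
    rw [Nat.card_Icc]
    omega
  rw [nsmul_eq_mul] at hlow
  have := (hlow.trans hsum).trans key
  rw [Nat.card_Icc, Nat.add_sub_cancel] at this
  exact_mod_cast this

open Filter in
theorem stmt_14 (t l : ℕ → ℕ)
    (hto : Tendsto (fun m : ℕ => (t m : ℝ) / (m : ℝ)) atTop (nhds 0))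
    (hlo : Tendsto (fun m : ℕ => (l m : ℝ) / (m : ℝ)) atTop (nhds 0))
    (htl : Tendsto (fun m : ℕ => t m + l m) atTop atTop)
    (hts : Tendsto (fun m : ℕ => (t m : ℝ) / Real.sqrt (l m : ℝ)) atTop atTop) :
    Tendsto
      (fun m : ℕ => ((Fam (2 * m) m (t m) (l m)).card : ℝ) / (Nat.choose (2 * m) m : ℝ))
      atTop (nhds 0) := by
  have ht : Tendsto (fun m : ℕ => (t m : ℝ)) atTop atTop := by
    refine tendsto_atTop_mono (fun m => ?_) hts
    rcases Nat.eq_zero_or_pos (l m) with h | h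
    · simp [h]
    · exact div_le_self (Nat.cast_nonneg _) (Real.one_le_sqrt.2 (by exact_mod_cast h))
  have hbound : Tendsto (fun m : ℕ => (t m : ℝ)⁻¹ + 2 * ((t m : ℝ) / Real.sqrt (l m : ℝ))⁻¹ ^ 2)
      atTop (nhds 0) := by
    simpa using (tendsto_inv_atTop_zero.comp ht).add
      (((tendsto_inv_atTop_zero.comp hts).pow 2).const_mul 2)
  refine squeeze_zero' (Eventually.of_forall fun m => by positivity) ?_ hbound
  filter_upwards [hto.eventually_lt_const (show (0 : ℝ) < 1 / 2 by norm_num),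
    hlo.eventually_lt_const (show (0 : ℝ) < 1 / 2 by norm_num), ht.eventually_gt_atTop 0,
    eventually_gt_atTop 0] with m h1 h2 htpos hm
  have hm' : (0 : ℝ) < m := by exact_mod_cast hm
  rw [div_lt_iff₀ hm'] at h1 h2
  have hle : t m + 2 * l m ≤ 2 * m := by
    have : (t m : ℝ) + 2 * l m ≤ 2 * m := by linarith
    exact_mod_cast this
  have hcard : ((Fam (2 * m) m (t m) (l m)).card : ℝ) * (t m : ℝ) ^ 2
      ≤ ((t m : ℝ) + 2 * l m) * (2 * m).choose m := by
    exact_mod_cast card_Fam_mul_sq_le hle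
  have hC : (0 : ℝ) < (2 * m).choose m := by
    exact_mod_cast Nat.choose_pos (by omega)
  have heq : (t m : ℝ)⁻¹ + 2 * ((t m : ℝ) / Real.sqrt (l m : ℝ))⁻¹ ^ 2
      = ((t m : ℝ) + 2 * l m) / (t m : ℝ) ^ 2 := by
    rw [inv_div, div_pow, Real.sq_sqrt (Nat.cast_nonneg _)]
    field_simp
  rw [heq, div_le_div_iff₀ hC (by positivity)]
  exact hcard
end
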